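/- Assume the coercivity condition (C) and the monotonicity assumption (M). Let λ > 0, let (z,k) ∈ 𝕋ⁿ×𝕀, and let v^λ be the unique viscosity solution of (P_λ). Then there exists a family ν^{z,k,λ} = (ν^{z,k,λ}_i)_{i∈𝕀} ∈ G'(z,k,λ) such that v^λ_k(z) = ⟨ν^{z,k,λ}, L⟩. -/

import Mathlib

open MeasureTheory Filter Topology RealInnerProductSpace

noncomputable section

/-- Euclidean space ℝⁿ, the universal cover of the flat torus 𝕋ⁿ = ℝⁿ/ℤⁿ. -/
abbrev Euc (n : ℕ) := EuclideanSpace ℝ (Fin n)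

/-- A vector of ℝⁿ with integer coordinates (an element of ℤⁿ). -/
def IsIntVec {n : ℕ} (z : Euc n) : Prop := ∀ i, ∃ k : ℤ, z i = (k : ℝ)

/-- ℤⁿ-periodic functions on ℝⁿ: these represent functions on the torus 𝕋ⁿ. -/
def TorusFun {n : ℕ} {α : Type*} (f : Euc n → α) : Prop :=
  ∀ (x z : Euc n), IsIntVec z → f (x + z) = f x

/-- Functions on 𝕋ⁿ × Ξ, i.e. ℤⁿ-periodic in the first variable. -/
def TorusFun2 {n : ℕ} {Ξ : Type*} {α : Type*} (f : Euc n × Ξ → α) : Prop :=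
  ∀ (x z : Euc n) (ξ : Ξ), IsIntVec z → f (x + z, ξ) = f (x, ξ)

/-- The Hamiltonian H_{φ,i}(x,p) = sup_{ξ∈Ξ} (−g_i(x,ξ)·p − φ_i(x,ξ)). -/
def ham {n m : ℕ} {Ξ : Type*} (g : Fin m → Euc n × Ξ → Euc n)
    (φ : Fin m → Euc n × Ξ → ℝ) (i : Fin m) (x p : Euc n) : ℝ :=
  ⨆ ξ : Ξ, (-⟪g i (x, ξ), p⟫ - φ i (x, ξ))

/-- The data g = (g_i), L = (L_i) consist of continuous functions on 𝕋ⁿ × Ξ. -/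
def GoodData {n m : ℕ} {Ξ : Type*} [TopologicalSpace Ξ]
    (g : Fin m → Euc n × Ξ → Euc n) (L : Fin m → Euc n × Ξ → ℝ) : Prop :=
  (∀ i, Continuous (g i) ∧ TorusFun2 (g i)) ∧ (∀ i, Continuous (L i) ∧ TorusFun2 (L i))

/-- Coercivity (C): min_{x∈𝕋ⁿ} H_i(x,p) → ∞ as |p| → ∞. -/
def Coercive {n m : ℕ} {Ξ : Type*} (g : Fin m → Euc n × Ξ → Euc n)
    (L : Fin m → Euc n × Ξ → ℝ) : Prop :=
  ∀ (i : Fin m) (M : ℝ), ∃ R : ℝ, ∀ p : Euc n, R ≤ ‖p‖ → ∀ x : Euc n, M ≤ ham g L i x p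

/-- A monotone m×m real matrix. -/
def IsMonotoneMat {m : ℕ} (B : Matrix (Fin m) (Fin m) ℝ) : Prop :=
  ∀ (u : Fin m → ℝ) (k : Fin m), (∀ i, u i ≤ u k) → 0 ≤ u k → 0 ≤ ∑ j, B k j * u j

/-- Assumption (M): B(x) has continuous entries (as functions on 𝕋ⁿ) and is monotone
for every x. -/
def GoodCoupling {n m : ℕ} (B : Euc n → Matrix (Fin m) (Fin m) ℝ) : Prop :=
  (∀ i j, Continuous (fun x => B x i j) ∧ TorusFun (fun x => B x i j)) ∧
    ∀ x, IsMonotoneMat (B x)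

/-- Viscosity subsolution of λu + Bu + H_φ[u] = c in 𝕋ⁿ. -/
def IsSubsol {n m : ℕ} {Ξ : Type*} (B : Euc n → Matrix (Fin m) (Fin m) ℝ) (lam : ℝ)
    (g : Fin m → Euc n × Ξ → Euc n) (φ : Fin m → Euc n × Ξ → ℝ)
    (c : Fin m → ℝ) (u : Fin m → Euc n → ℝ) : Prop :=
  (∀ i, UpperSemicontinuous (u i) ∧ TorusFun (u i)) ∧
    ∀ (i : Fin m) (ψ : Euc n → ℝ), ContDiff ℝ 1 ψ → TorusFun ψ →
      ∀ x : Euc n, IsLocalMax (fun y => u i y - ψ y) x →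
        lam * u i x + (∑ j, B x i j * u j x) + ham g φ i x (gradient ψ x) ≤ c i

/-- Viscosity supersolution of λu + Bu + H_φ[u] = c in 𝕋ⁿ. -/
def IsSupersol {n m : ℕ} {Ξ : Type*} (B : Euc n → Matrix (Fin m) (Fin m) ℝ) (lam : ℝ)
    (g : Fin m → Euc n × Ξ → Euc n) (φ : Fin m → Euc n × Ξ → ℝ)
    (c : Fin m → ℝ) (u : Fin m → Euc n → ℝ) : Prop :=
  (∀ i, LowerSemicontinuous (u i) ∧ TorusFun (u i)) ∧
    ∀ (i : Fin m) (ψ : Euc n → ℝ), ContDiff ℝ 1 ψ → TorusFun ψ →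
      ∀ x : Euc n, IsLocalMin (fun y => u i y - ψ y) x →
        c i ≤ lam * u i x + (∑ j, B x i j * u j x) + ham g φ i x (gradient ψ x)

/-- Viscosity solution of λu + Bu + H_φ[u] = c in 𝕋ⁿ. -/
def IsSol {n m : ℕ} {Ξ : Type*} (B : Euc n → Matrix (Fin m) (Fin m) ℝ) (lam : ℝ)
    (g : Fin m → Euc n × Ξ → Euc n) (φ : Fin m → Euc n × Ξ → ℝ)
    (c : Fin m → ℝ) (u : Fin m → Euc n → ℝ) : Prop :=
  (∀ i, Continuous (u i)) ∧ IsSubsol B lam g φ c u ∧ IsSupersol B lam g φ c u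

/-- (φ,u) ∈ F(λ): φ ∈ C(𝕋ⁿ×Ξ)ᵐ, u ∈ C(𝕋ⁿ)ᵐ and u is a viscosity subsolution of
B^λ u + H_φ[u] = 0 in 𝕋ⁿ. -/
def memF {n m : ℕ} {Ξ : Type*} [TopologicalSpace Ξ]
    (B : Euc n → Matrix (Fin m) (Fin m) ℝ) (lam : ℝ)
    (g : Fin m → Euc n × Ξ → Euc n)
    (φ : Fin m → Euc n × Ξ → ℝ) (u : Fin m → Euc n → ℝ) : Prop :=
  (∀ i, Continuous (φ i) ∧ TorusFun2 (φ i)) ∧ (∀ i, Continuous (u i)) ∧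
    IsSubsol B lam g φ (fun _ => 0) u

/-- ρ_i(x) = Σ_j b_{ij}(x). -/
def rhoB {n m : ℕ} (B : Euc n → Matrix (Fin m) (Fin m) ℝ) (i : Fin m) (x : Euc n) : ℝ :=
  ∑ j, B x i j

/-- ν ∈ P_{B^λ}: a family of finite nonnegative Borel measures with ⟨ν, B^λ1⟩ = 1. -/
def memPB {n m : ℕ} {Ξ : Type*} [MeasurableSpace Ξ]
    (B : Euc n → Matrix (Fin m) (Fin m) ℝ) (lam : ℝ)
    (ν : Fin m → Measure (Euc n × Ξ)) : Prop :=
  (∀ i, IsFiniteMeasure (ν i)) ∧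
    (∑ i, ∫ q, (lam + rhoB B i q.1) ∂(ν i)) = 1

/-- ν ∈ G'(z,k,λ): ν ∈ P_{B^λ} and ⟨ν, φ − u_k(z) B^λ1⟩ ≥ 0 for every (φ,u) ∈ F(λ). -/
def memGP {n m : ℕ} {Ξ : Type*} [TopologicalSpace Ξ] [MeasurableSpace Ξ]
    (B : Euc n → Matrix (Fin m) (Fin m) ℝ) (lam : ℝ)
    (g : Fin m → Euc n × Ξ → Euc n) (z : Euc n) (k : Fin m)
    (ν : Fin m → Measure (Euc n × Ξ)) : Prop :=
  memPB B lam ν ∧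
    ∀ φ u, memF B lam g φ u →
      0 ≤ ∑ i, ∫ q, (φ i q - u k z * (lam + rhoB B i q.1)) ∂(ν i)

/-- μ ∈ P: a family of nonnegative Borel measures of total mass 1. -/
def memP {n m : ℕ} {Ξ : Type*} [MeasurableSpace Ξ]
    (μ : Fin m → Measure (Euc n × Ξ)) : Prop :=
  (∀ i, IsFiniteMeasure (μ i)) ∧ (∑ i, (μ i Set.univ).toReal) = 1

/-- μ ∈ P(z,k,λ): μ ∈ P and Σ_i ⟨μ_i, (λ+ρ_i)⁻¹ φ_i⟩ ≥ u_k(z) for all (φ,u) ∈ F(λ). -/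
def memPzk {n m : ℕ} {Ξ : Type*} [TopologicalSpace Ξ] [MeasurableSpace Ξ]
    (B : Euc n → Matrix (Fin m) (Fin m) ℝ) (lam : ℝ)
    (g : Fin m → Euc n × Ξ → Euc n) (z : Euc n) (k : Fin m)
    (μ : Fin m → Measure (Euc n × Ξ)) : Prop :=
  memP μ ∧
    ∀ φ u, memF B lam g φ u →
      u k z ≤ ∑ i, ∫ q, (lam + rhoB B i q.1)⁻¹ * φ i q ∂(μ i)

/-- μ ∈ P(0): μ ∈ P and ⟨μ,φ⟩ ≥ 0 for all (φ,u) ∈ F(0). -/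
def memP0 {n m : ℕ} {Ξ : Type*} [TopologicalSpace Ξ] [MeasurableSpace Ξ]
    (B : Euc n → Matrix (Fin m) (Fin m) ℝ)
    (g : Fin m → Euc n × Ξ → Euc n)
    (μ : Fin m → Measure (Euc n × Ξ)) : Prop :=
  memP μ ∧ ∀ φ u, memF B 0 g φ u → 0 ≤ ∑ i, ∫ q, φ i q ∂(μ i)

/-- μ ∈ M₊(0): a family of finite nonnegative Borel measures with ⟨μ,φ⟩ ≥ 0 for all
(φ,u) ∈ F(0). -/
def memM0 {n m : ℕ} {Ξ : Type*} [TopologicalSpace Ξ] [MeasurableSpace Ξ]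
    (B : Euc n → Matrix (Fin m) (Fin m) ℝ)
    (g : Fin m → Euc n × Ξ → Euc n)
    (μ : Fin m → Measure (Euc n × Ξ)) : Prop :=
  (∀ i, IsFiniteMeasure (μ i)) ∧ ∀ φ u, memF B 0 g φ u → 0 ≤ ∑ i, ∫ q, φ i q ∂(μ i)

/-- Assumption (E): problem (P₀) has a Lipschitz continuous viscosity solution. -/
def AssumptionE {n m : ℕ} {Ξ : Type*} (B : Euc n → Matrix (Fin m) (Fin m) ℝ)
    (g : Fin m → Euc n × Ξ → Euc n) (L : Fin m → Euc n × Ξ → ℝ) : Prop :=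
  ∃ v₀ : Fin m → Euc n → ℝ, (∀ i, ∃ K : NNReal, LipschitzWith K (v₀ i)) ∧
    IsSol B 0 g L (fun _ => 0) v₀

end


/-- Periodic smooth penalization. -/
noncomputable def pen {n : ℕ} (w : Euc n) : ℝ := ∑ j, (1 - Real.cos (2 * Real.pi * w j))

theorem pen_contDiff {n : ℕ} : ContDiff ℝ 1 (pen (n := n)) := by
  unfold pen; fun_prop

theorem pen_nonneg {n : ℕ} (w : Euc n) : 0 ≤ pen w :=
  Finset.sum_nonneg fun j _ => by linarith [Real.cos_le_one (2 * Real.pi * w j)]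

theorem pen_zero {n : ℕ} : pen (0 : Euc n) = 0 := by simp [pen]

theorem pen_intVec {n : ℕ} {w : Euc n} (h : pen w ≤ 0) : IsIntVec w := by
  have h0 : pen w = 0 := le_antisymm h (pen_nonneg w)
  intro j
  have h1 := (Finset.sum_eq_zero_iff_of_nonneg (fun j _ => by
    linarith [Real.cos_le_one (2 * Real.pi * w j)])).1 h0 j (Finset.mem_univ j)
  obtain ⟨a, ha⟩ := (Real.cos_eq_one_iff _).1 (by linarith : Real.cos (2 * Real.pi * w j) = 1)
  refine ⟨a, ?_⟩
  have := Real.pi_pos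
  have h2 : 2 * Real.pi * (a - w j) = 0 := by linarith
  have := (mul_eq_zero.1 h2).resolve_left (by positivity)
  linarith

theorem pen_torus {n : ℕ} : TorusFun (pen (n := n)) := by
  intro x z hz
  unfold pen
  refine Finset.sum_congr rfl fun j _ => ?_
  obtain ⟨a, ha⟩ := hz j
  have : 2 * Real.pi * (x + z) j = 2 * Real.pi * x j + a * (2 * Real.pi) := by
    simp [ha]; ring
  rw [this, Real.cos_add_int_mul_two_pi]

theorem IsIntVec.neg {n : ℕ} {w : Euc n} (h : IsIntVec w) : IsIntVec (-w) := by
  intro j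
  obtain ⟨a, ha⟩ := h j
  exact ⟨-a, by simp [ha]⟩

theorem pen_torus_sub {n : ℕ} (y : Euc n) : TorusFun (fun x => pen (x - y)) := by
  intro x z hz
  have : x + z - y = x - y + z := by abel
  simp only [this, pen_torus _ z hz]

theorem pen_torus_sub' {n : ℕ} (x : Euc n) : TorusFun (fun y => pen (x - y)) := by
  intro y z hz
  have : x - (y + z) = x - y + (-z) := by abel
  simp only [this, pen_torus _ (-z) hz.neg]

theorem grad_add {n : ℕ} {f h : Euc n → ℝ} {x : Euc n} (hf : DifferentiableAt ℝ f x)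
    (hh : DifferentiableAt ℝ h x) :
    gradient (fun y => f y + h y) x = gradient f x + gradient h x := by
  unfold gradient
  rw [fderiv_fun_add hf hh, map_add]

theorem grad_mul {n : ℕ} {f : Euc n → ℝ} {x : Euc n} (hf : DifferentiableAt ℝ f x) (c : ℝ) :
    gradient (fun y => c * f y) x = c • gradient f x := by
  unfold gradient
  rw [fderiv_const_mul hf]
  simp

theorem pen_diff {n : ℕ} (w : Euc n) : DifferentiableAt ℝ pen w :=
  pen_contDiff.differentiable one_ne_zero w

theorem grad_pen_sub {n : ℕ} (x y : Euc n) :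
    gradient (fun x => pen (x - y)) x = gradient pen (x - y) := by
  unfold gradient
  rw [fderiv_comp_sub]

theorem grad_pen_sub' {n : ℕ} (x y : Euc n) :
    gradient (fun y => pen (x - y)) y = - gradient pen (x - y) := by
  unfold gradient
  have h1 : HasFDerivAt (fun y : Euc n => x - y) (-ContinuousLinearMap.id ℝ (Euc n)) y :=
    (hasFDerivAt_id y).const_sub x
  have h2 := (pen_diff (x - y)).hasFDerivAt.comp y h1
  have h3 := h2.fderiv
  simp only [Function.comp_def] at h3
  rw [h3, ← map_neg]
  congr 1
  ext; simp

theorem pen_diff_sub {n : ℕ} (x y : Euc n) : DifferentiableAt ℝ (fun x => pen (x - y)) x :=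
  (pen_contDiff.comp (contDiff_id.sub contDiff_const)).differentiable one_ne_zero x

theorem pen_diff_sub' {n : ℕ} (x y : Euc n) : DifferentiableAt ℝ (fun y => pen (x - y)) y :=
  (pen_contDiff.comp (contDiff_const.sub contDiff_id)).differentiable one_ne_zero y

theorem grad_pen_zero {n : ℕ} : gradient pen (0 : Euc n) = 0 := by
  unfold gradient
  have : IsLocalMin pen (0 : Euc n) := Eventually.of_forall fun x => by
    rw [pen_zero]; exact pen_nonneg x
  rw [this.fderiv_eq_zero, map_zero]

theorem grad_cont {n : ℕ} {f : Euc n → ℝ} (hf : ContDiff ℝ 1 f) : Continuous (gradient f) := by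
  unfold gradient
  exact (LinearIsometryEquiv.continuous _).comp (hf.continuous_fderiv one_ne_zero)

/-- every point is equivalent to one in the compact ball -/
theorem exists_rep {n : ℕ} (x : Euc n) :
    ∃ w, IsIntVec w ∧ x + w ∈ Metric.closedBall (0 : Euc n) n := by
  refine ⟨WithLp.toLp 2 fun j => -(⌊x j⌋ : ℝ), fun j => ⟨-⌊x j⌋, by simp⟩, ?_⟩
  rw [mem_closedBall_zero_iff, EuclideanSpace.norm_eq]
  apply Real.sqrt_le_iff.2
  refine ⟨by positivity, ?_⟩
  calc _ ≤ ∑ j : Fin n, (1 : ℝ) := by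
        refine Finset.sum_le_sum fun j _ => ?_
        have h1 := Int.fract_nonneg (x j)
        have h2 := (Int.fract_lt_one (x j)).le
        have : (x + WithLp.toLp 2 fun j => -(⌊x j⌋ : ℝ)) j = Int.fract (x j) := by
          simp [Int.fract, sub_eq_add_neg]
        rw [this, Real.norm_eq_abs, sq_abs]
        nlinarith
    _ = n := by simp
    _ ≤ (n : ℝ) ^ 2 := by
        rcases Nat.eq_zero_or_pos n with h | h
        · simp [h]
        · have : (1 : ℝ) ≤ n := by exact_mod_cast h
          nlinarith

theorem bdd1 {n : ℕ} {f : Euc n → ℝ} (hf : Continuous f) (ht : TorusFun f) :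
    ∃ C, ∀ x, |f x| ≤ C := by
  obtain ⟨C, hC⟩ := (isCompact_closedBall (0 : Euc n) n).exists_bound_of_continuousOn
    hf.continuousOn
  refine ⟨C, fun x => ?_⟩
  obtain ⟨w, hw, hx⟩ := exists_rep x
  have := hC _ hx
  rwa [ht _ _ hw] at this

theorem bdd2 {n : ℕ} {Ξ : Type*} [MetricSpace Ξ] [CompactSpace Ξ] {f : Euc n × Ξ → ℝ}
    (hf : Continuous f) (ht : TorusFun2 f) :
    ∃ C, ∀ q, |f q| ≤ C := by
  obtain ⟨C, hC⟩ := ((isCompact_closedBall (0 : Euc n) n).prod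
    (isCompact_univ (X := Ξ))).exists_bound_of_continuousOn hf.continuousOn
  refine ⟨C, fun ⟨x, ξ⟩ => ?_⟩
  obtain ⟨w, hw, hx⟩ := exists_rep x
  have := hC (x + w, ξ) ⟨hx, Set.mem_univ _⟩
  rwa [ht _ _ _ hw] at this

set_option linter.unusedSectionVars false

section Main

variable {n m : ℕ} {Ξ : Type*} [MetricSpace Ξ] [CompactSpace Ξ] [Nonempty Ξ]
  {g : Fin m → Euc n × Ξ → Euc n} {L : Fin m → Euc n × Ξ → ℝ}
  {B : Euc n → Matrix (Fin m) (Fin m) ℝ} {lam : ℝ}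

theorem ham_cont {φ : Fin m → Euc n × Ξ → ℝ} (hg : ∀ i, Continuous (g i))
    (hφ : ∀ i, Continuous (φ i)) (i : Fin m) (x p : Euc n) :
    Continuous (fun ξ : Ξ => -⟪g i (x, ξ), p⟫ - φ i (x, ξ)) := by
  have := hg i
  have := hφ i
  fun_prop

theorem le_ham {φ : Fin m → Euc n × Ξ → ℝ} (hg : ∀ i, Continuous (g i))
    (hφ : ∀ i, Continuous (φ i)) (i : Fin m) (x p : Euc n) (ξ : Ξ) :
    -⟪g i (x, ξ), p⟫ - φ i (x, ξ) ≤ ham g φ i x p :=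
  le_ciSup (f := fun ξ : Ξ => -⟪g i (x, ξ), p⟫ - φ i (x, ξ))
    (isCompact_range (ham_cont hg hφ i x p)).bddAbove ξ

theorem exists_ham {φ : Fin m → Euc n × Ξ → ℝ} (hg : ∀ i, Continuous (g i))
    (hφ : ∀ i, Continuous (φ i)) (i : Fin m) (x p : Euc n) :
    ∃ ξ : Ξ, ham g φ i x p ≤ -⟪g i (x, ξ), p⟫ - φ i (x, ξ) := by
  obtain ⟨ξ, -, h⟩ := isCompact_univ.exists_isMaxOn Set.univ_nonempty
    (ham_cont hg hφ i x p).continuousOn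
  exact ⟨ξ, ciSup_le fun η => h (Set.mem_univ η)⟩

/-- Gradients at test points of subsolutions are bounded. -/
theorem grad_bound (hgL : GoodData g L) (hcoer : Coercive g L) (hB : GoodCoupling B)
    {φ : Fin m → Euc n × Ξ → ℝ} {u : Fin m → Euc n → ℝ} (h : memF B lam g φ u) :
    ∃ R, ∀ (i : Fin m) (ψ : Euc n → ℝ), ContDiff ℝ 1 ψ → TorusFun ψ →
      ∀ x : Euc n, IsLocalMax (fun y => u i y - ψ y) x → ‖gradient ψ x‖ ≤ R := by
  obtain ⟨hφ, hu, hut, hs⟩ := h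
  have hg := fun i => (hgL.1 i).1
  have key : ∀ i : Fin m, ∃ R, ∀ (ψ : Euc n → ℝ), ContDiff ℝ 1 ψ → TorusFun ψ →
      ∀ x : Euc n, IsLocalMax (fun y => u i y - ψ y) x → ‖gradient ψ x‖ ≤ R := by
    intro i
    obtain ⟨C1, hC1⟩ := bdd1 (f := fun x => lam * u i x + (∑ j, B x i j * u j x))
      ((continuous_const.mul (hu i)).add
        (continuous_finsetSum _ fun j _ => (hB.1 i j).1.mul (hu j)))
      (by
        intro x w hw
        have h1 : ∀ j, B (x + w) i j = B x i j := fun j => (hB.1 i j).2 x w hw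
        have h2 : ∀ j, u j (x + w) = u j x := fun j => (hut j).2 x w hw
        simp only [h1, h2])
    obtain ⟨C2, hC2⟩ := bdd2 (f := fun q => φ i q - L i q) ((hφ i).1.sub (hgL.2 i).1)
      (by intro x w ξ hw; simp only [(hφ i).2 x w ξ hw, (hgL.2 i).2 x w ξ hw])
    obtain ⟨R, hR⟩ := hcoer i (C1 + C2 + 1)
    refine ⟨R, fun ψ hψ hψt x hx => ?_⟩
    by_contra hlt
    have h1 := hR _ (not_le.1 hlt).le x
    obtain ⟨ξ, hξ⟩ := exists_ham hg (fun i => (hgL.2 i).1) i x (gradient ψ x)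
    have h2 := hs i ψ hψ hψt x hx
    have h3 := le_ham hg (fun i => (hφ i).1) i x (gradient ψ x) ξ
    have h4 := (abs_le.1 (hC1 x)).1
    have h5 := (abs_le.1 (hC2 (x, ξ))).2
    simp only at h2 h4 h5
    linarith
  choose R hR using key
  refine ⟨∑ i, |R i|, fun i ψ hψ hψt x hx => (hR i ψ hψ hψt x hx).trans ?_⟩
  exact (le_abs_self _).trans (Finset.single_le_sum (f := fun i => |R i|)
    (fun _ _ => abs_nonneg _) (Finset.mem_univ i))

theorem sub_pt (hgL : GoodData g L) {φ : Fin m → Euc n × Ξ → ℝ} {u : Fin m → Euc n → ℝ}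
    (h : memF B lam g φ u) (i : Fin m) (ψ : Euc n → ℝ) (hψ : ContDiff ℝ 1 ψ) (hψt : TorusFun ψ)
    (x : Euc n) (hx : IsLocalMax (fun y => u i y - ψ y) x) (ξ : Ξ) :
    lam * u i x + (∑ j, B x i j * u j x) + (-⟪g i (x, ξ), gradient ψ x⟫ - φ i (x, ξ)) ≤ 0 := by
  have h1 := h.2.2.2 i ψ hψ hψt x hx
  have h2 := le_ham (fun i => (hgL.1 i).1) (fun i => (h.1 i).1) i x (gradient ψ x) ξ
  simp only at h1
  linarith

theorem lim_pen {a b : ℕ → ℝ} {A C : ℝ} {s : ℕ → ℕ} (hs : StrictMono s)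
    (ha : Tendsto a atTop (𝓝 A)) (hb : Tendsto b atTop (𝓝 C))
    (h : ∀ k, (s k : ℝ) * a k ≤ b k) : A ≤ 0 := by
  have h1 : Tendsto (fun k => (s k : ℝ)) atTop atTop :=
    tendsto_natCast_atTop_atTop.comp hs.tendsto_atTop
  have h2 := hb.div_atTop h1
  refine le_of_tendsto_of_tendsto ha h2 ?_
  filter_upwards [h1.eventually_gt_atTop 0] with k hk
  rw [le_div_iff₀ hk]
  linarith [h k]

/-- The operator evaluated at a control. -/
noncomputable def opv (B : Euc n → Matrix (Fin m) (Fin m) ℝ) (lam : ℝ) (g : Fin m → Euc n × Ξ → Euc n)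
    (φ : Fin m → Euc n × Ξ → ℝ) (u : Fin m → Euc n → ℝ)
    (i : Fin m) (x : Euc n) (ξ : Ξ) (p : Euc n) : ℝ :=
  lam * u i x + (∑ j, B x i j * u j x) + (-⟪g i (x, ξ), p⟫ - φ i (x, ξ))

theorem opv_cont {φ : Fin m → Euc n × Ξ → ℝ} {u : Fin m → Euc n → ℝ} (hB : GoodCoupling B)
    (hg : ∀ i, Continuous (g i)) (hφ : ∀ i, Continuous (φ i)) (hu : ∀ i, Continuous (u i))
    (i : Fin m) :
    Continuous (fun q : Euc n × Ξ × Euc n => opv B lam g φ u i q.1 q.2.1 q.2.2) := by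
  unfold opv
  have h1 := hg i
  have h2 := hφ i
  refine ((continuous_const.mul ((hu i).comp continuous_fst)).add
    (continuous_finsetSum _ fun j _ => ((hB.1 i j).1.comp continuous_fst).mul
      ((hu j).comp continuous_fst))).add ?_
  fun_prop

set_option maxHeartbeats 1000000 in
/-- Comparison. -/
theorem comparison (hgL : GoodData g L) (hcoer : Coercive g L) (hB : GoodCoupling B)
    (hlam : 0 < lam) {u v : Fin m → Euc n → ℝ} (hu : memF B lam g L u)
    (hvc : ∀ i, Continuous (v i)) (hv : IsSupersol B lam g L (fun _ => 0) v)
    (k : Fin m) (z : Euc n) : u k z ≤ v k z := by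
  by_contra hlt
  rw [not_le] at hlt
  have : Nonempty (Fin m) := ⟨k⟩
  obtain ⟨R, hR⟩ := grad_bound hgL hcoer hB hu
  have huc := hu.2.1
  have hut := fun i => (hu.2.2.1 i).2
  have hvt := fun i => (hv.1 i).2
  have hBc := fun i j => (hB.1 i j).1
  have hgc := fun i => (hgL.1 i).1
  have hLc := fun i => (hgL.2 i).1
  have hpc : Continuous (pen (n := n)) := pen_contDiff.continuous
  -- approximate points
  have key : ∀ K : ℕ, ∃ P : Fin m × Euc n × Euc n × Ξ × Euc n,
      P ∈ (Set.univ : Set (Fin m)) ×ˢ Metric.closedBall (0 : Euc n) n ×ˢ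
        Metric.closedBall (0 : Euc n) n ×ˢ (Set.univ : Set Ξ) ×ˢ Metric.closedBall (0 : Euc n) R ∧
      (∀ j w, u j w - v j w ≤ u P.1 P.2.1 - v P.1 P.2.2.1 - K * pen (P.2.1 - P.2.2.1)) ∧
      opv B lam g L u P.1 P.2.1 P.2.2.2.1 P.2.2.2.2 ≤ 0 ∧
      0 ≤ opv B lam g L v P.1 P.2.2.1 P.2.2.2.1 P.2.2.2.2 := by
    intro K
    have hc : Continuous (fun q : Fin m × Euc n × Euc n =>
        u q.1 q.2.1 - v q.1 q.2.2 - K * pen (q.2.1 - q.2.2)) := by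
      rw [continuous_prod_of_discrete_left]
      intro i
      have := huc i
      have := hvc i
      dsimp only
      fun_prop
    obtain ⟨⟨i, x, y⟩, hmem, hmax⟩ := ((isCompact_univ (X := Fin m)).prod
      ((isCompact_closedBall (0 : Euc n) n).prod
        (isCompact_closedBall (0 : Euc n) n))).exists_isMaxOn
      ⟨(k, 0, 0), by simp⟩ hc.continuousOn
    have hglob : ∀ j a b, u j a - v j b - K * pen (a - b) ≤ u i x - v i y - K * pen (x - y) := by
      intro j a b
      obtain ⟨w, hw, ha⟩ := exists_rep a
      obtain ⟨w', hw', hb⟩ := exists_rep b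
      have := hmax (show (j, a + w, b + w') ∈ _ from ⟨Set.mem_univ _, ha, hb⟩)
      have e1 : pen (a + w - (b + w')) = pen (a - b) := by
        have h1 := pen_torus_sub (b + w') a w hw
        have h2 := pen_torus_sub' a b w' hw'
        simp only at h1 h2
        rw [h1, h2]
      simpa [hut j _ _ hw, hvt j _ _ hw', e1] using this
    have hg1 : gradient (fun a => (K : ℝ) * pen (a - y)) x = (K : ℝ) • gradient pen (x - y) := by
      rw [grad_mul (pen_diff_sub x y), grad_pen_sub]
    have hg2 : gradient (fun b => (-K : ℝ) * pen (x - b)) y = (K : ℝ) • gradient pen (x - y) := by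
      rw [grad_mul (pen_diff_sub' x y), grad_pen_sub']
      simp
    have hc1 : ContDiff ℝ 1 (fun a : Euc n => (K : ℝ) * pen (a - y)) :=
      contDiff_const.mul (pen_contDiff.comp (contDiff_id.sub contDiff_const))
    have hc2 : ContDiff ℝ 1 (fun b : Euc n => (-K : ℝ) * pen (x - b)) :=
      contDiff_const.mul (pen_contDiff.comp (contDiff_const.sub contDiff_id))
    have ht1 : TorusFun (fun a : Euc n => (K : ℝ) * pen (a - y)) := by
      intro a w hw
      have := pen_torus_sub y a w hw
      simp only at this
      simp only [this]
    have ht2 : TorusFun (fun b : Euc n => (-K : ℝ) * pen (x - b)) := by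
      intro a w hw
      have := pen_torus_sub' x a w hw
      simp only at this
      simp only [this]
    have hm1 : IsLocalMax (fun a => u i a - (K : ℝ) * pen (a - y)) x :=
      Eventually.of_forall fun a => by
        have := hglob i a y
        simp only
        linarith
    have hm2 : IsLocalMin (fun b => v i b - (-K : ℝ) * pen (x - b)) y :=
      Eventually.of_forall fun b => by
        have := hglob i x b
        simp only
        linarith
    have hR1 := hR i _ hc1 ht1 x hm1
    have hs := hv.2 i _ hc2 ht2 y hm2
    obtain ⟨ξ, hξ⟩ := exists_ham hgc hLc i y (gradient (fun b => (-K : ℝ) * pen (x - b)) y)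
    have hsub := sub_pt hgL hu i _ hc1 ht1 x hm1 ξ
    rw [hg1] at hR1 hsub
    rw [hg2] at hs hξ
    refine ⟨(i, x, y, ξ, (K : ℝ) • gradient pen (x - y)),
      ⟨Set.mem_univ _, hmem.2.1, hmem.2.2, Set.mem_univ _, ?_⟩, ?_, hsub, ?_⟩
    · simpa using hR1
    · intro j w
      have := hglob j w w
      simpa [pen_zero] using this
    · unfold opv
      simp only at hs ⊢
      linarith
  choose P hPmem hP1 hP2 hP3 using key
  obtain ⟨⟨i, x, y, ξ, p⟩, -, s, hs, hlim⟩ :=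
    ((isCompact_univ (X := Fin m)).prod ((isCompact_closedBall (0 : Euc n) n).prod
      ((isCompact_closedBall (0 : Euc n) n).prod ((isCompact_univ (X := Ξ)).prod
        (isCompact_closedBall (0 : Euc n) R))))).tendsto_subseq hPmem
  have c1 : Continuous (fun P : Fin m × Euc n × Euc n × Ξ × Euc n =>
      u P.1 P.2.1 - v P.1 P.2.2.1) := by
    rw [continuous_prod_of_discrete_left]
    intro i
    have := huc i
    have := hvc i
    dsimp only
    fun_prop
  have c1' : Continuous (fun P : Fin m × Euc n × Euc n × Ξ × Euc n =>
      v P.1 P.2.1 - v P.1 P.2.2.1) := by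
    rw [continuous_prod_of_discrete_left]
    intro i
    have := hvc i
    dsimp only
    fun_prop
  have c2 : Continuous (fun P : Fin m × Euc n × Euc n × Ξ × Euc n =>
      opv B lam g L u P.1 P.2.1 P.2.2.2.1 P.2.2.2.2) := by
    rw [continuous_prod_of_discrete_left]
    intro i
    exact (opv_cont (lam := lam) hB hgc hLc huc i).comp
      (f := fun q : Euc n × Euc n × Ξ × Euc n => (q.1, q.2.2.1, q.2.2.2)) (by fun_prop)
  have c3 : Continuous (fun P : Fin m × Euc n × Euc n × Ξ × Euc n =>
      opv B lam g L v P.1 P.2.2.1 P.2.2.2.1 P.2.2.2.2) := by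
    rw [continuous_prod_of_discrete_left]
    intro i
    exact (opv_cont (lam := lam) hB hgc hLc hvc i).comp
      (f := fun q : Euc n × Euc n × Ξ × Euc n => (q.2.1, q.2.2.1, q.2.2.2)) (by fun_prop)
  have c4 : Continuous (fun P : Fin m × Euc n × Euc n × Ξ × Euc n => pen (P.2.1 - P.2.2.1)) := by
    fun_prop
  have l1 : ∀ j w, u j w - v j w ≤ u i x - v i y := by
    intro j w
    refine ge_of_tendsto ((c1.tendsto _).comp hlim) (Eventually.of_forall fun K => ?_)
    have h1 := hP1 (s K) j w
    have h2 : 0 ≤ (s K : ℝ) * pen ((P (s K)).2.1 - (P (s K)).2.2.1) :=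
      mul_nonneg (Nat.cast_nonneg _) (pen_nonneg _)
    simp only [Function.comp]
    linarith
  have l2 : opv B lam g L u i x ξ p ≤ 0 := le_of_tendsto ((c2.tendsto _).comp hlim) (Eventually.of_forall fun K => by exact hP2 (s K))
  have l3 : 0 ≤ opv B lam g L v i y ξ p := ge_of_tendsto ((c3.tendsto _).comp hlim) (Eventually.of_forall fun K => by exact hP3 (s K))
  have l4 : pen (x - y) ≤ 0 := by
    have t4 := (c4.tendsto (i, x, y, ξ, p)).comp hlim
    have t1 := (c1'.tendsto (i, x, y, ξ, p)).comp hlim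
    dsimp only at t4 t1
    refine lim_pen hs t4 t1 fun K => ?_
    have := hP1 (s K) (P (s K)).1 (P (s K)).2.1
    simp only [Function.comp]
    linarith
  have hw := pen_intVec l4
  unfold opv at l2 l3
  obtain ⟨w, rfl⟩ : ∃ w, x = y + w := ⟨x - y, by abel⟩
  rw [add_sub_cancel_left] at hw
  have e1 : ∀ j, B (y + w) i j = B y i j := fun j => (hB.1 i j).2 y w hw
  have e2 : ∀ j, u j (y + w) = u j y := fun j => hut j y w hw
  rw [(hgL.1 i).2 y w ξ hw, (hgL.2 i).2 y w ξ hw] at l2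
  simp only [e1, e2] at l1 l2
  have hpos : 0 < u i y - v i y := by linarith [l1 k z]
  have hmon := hB.2 y (fun j => u j y - v j y) i (fun j => l1 j y) hpos.le
  simp only [mul_sub, Finset.sum_sub_distrib] at hmon
  have := mul_pos hlam hpos
  linarith
theorem pen_close {x y c : Euc n} {r : ℝ} (hr : r ≤ 1 / 3) (hx : x ∈ Metric.closedBall c r)
    (hy : y ∈ Metric.closedBall c r) (h : pen (x - y) ≤ 0) : x = y := by
  have h1 := pen_intVec h
  have hd : ‖x - y‖ < 1 := by
    rw [← dist_eq_norm]
    have := dist_triangle_right x y c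
    rw [Metric.mem_closedBall] at hx hy
    linarith
  ext j
  obtain ⟨a, ha⟩ := h1 j
  have h2 := PiLp.norm_apply_le (x - y) j
  rw [ha, Real.norm_eq_abs] at h2
  have h3 : |(a : ℝ)| < 1 := by linarith
  have h4 : a = 0 := by
    rw [← Int.abs_lt_one_iff]
    exact_mod_cast h3
  rw [h4] at ha
  simp only [PiLp.sub_apply, Int.cast_zero] at ha
  linarith

set_option maxHeartbeats 1000000 in
/-- Doubling for sums: approximate points. -/
theorem sum_approx (hgL : GoodData g L) (hcoer : Coercive g L) (hB : GoodCoupling B)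
    {φ₁ φ₂ : Fin m → Euc n × Ξ → ℝ} {u₁ u₂ : Fin m → Euc n → ℝ}
    (h₁ : memF B lam g φ₁ u₁) (h₂ : memF B lam g φ₂ u₂)
    (i : Fin m) {ψ : Euc n → ℝ} (hψ : ContDiff ℝ 1 ψ) (hψt : TorusFun ψ) {c : Euc n}
    (hc : IsLocalMax (fun y => (u₁ i y + u₂ i y) - ψ y) c) :
    ∃ R : ℝ, ∀ ε > 0, ∃ x y q : Euc n, dist x c < ε ∧ dist y c < ε ∧ ‖q‖ ≤ R ∧
      (∀ ξ, opv B lam g φ₁ u₁ i x ξ (gradient ψ x + gradient pen (x - c) - q) ≤ 0) ∧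
      (∀ ξ, opv B lam g φ₂ u₂ i y ξ q ≤ 0) := by
  obtain ⟨R, hR⟩ := grad_bound hgL hcoer hB h₂
  refine ⟨R, fun ε hε => ?_⟩
  obtain ⟨r₀, hr₀, hball⟩ := Metric.eventually_nhds_iff_ball.1 hc
  set r := min (r₀ / 2) (1 / 3) with hr
  have hrpos : 0 < r := lt_min (by linarith) (by norm_num)
  have hr3 : r ≤ 1 / 3 := min_le_right _ _
  have hloc : ∀ x ∈ Metric.closedBall c r, u₁ i x + u₂ i x - ψ x ≤ u₁ i c + u₂ i c - ψ c := by
    intro x hx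
    refine hball x ?_
    rw [Metric.mem_closedBall] at hx
    rw [Metric.mem_ball]
    have : r ≤ r₀ / 2 := min_le_left _ _
    linarith
  have hu1 := h₁.2.1 i
  have hu2 := h₂.2.1 i
  have hψc := hψ.continuous
  have hpc : Continuous (pen (n := n)) := pen_contDiff.continuous
  have hcc : c ∈ Metric.closedBall c r := Metric.mem_closedBall_self hrpos.le
  have key : ∀ K : ℕ, ∃ P : Euc n × Euc n, P ∈ Metric.closedBall c r ×ˢ Metric.closedBall c r ∧
      ∀ a ∈ Metric.closedBall c r, ∀ b ∈ Metric.closedBall c r,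
        u₁ i a + u₂ i b - ψ a - pen (a - c) - K * pen (a - b) ≤
        u₁ i P.1 + u₂ i P.2 - ψ P.1 - pen (P.1 - c) - K * pen (P.1 - P.2) := by
    intro K
    have hcont : Continuous (fun P : Euc n × Euc n =>
        u₁ i P.1 + u₂ i P.2 - ψ P.1 - pen (P.1 - c) - K * pen (P.1 - P.2)) := by
      fun_prop
    obtain ⟨P, hP, hmax⟩ := ((isCompact_closedBall c r).prod
      (isCompact_closedBall c r)).exists_isMaxOn ⟨(c, c), hcc, hcc⟩ hcont.continuousOn
    exact ⟨P, hP, fun a ha b hb => hmax (show (a, b) ∈ _ from ⟨ha, hb⟩)⟩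
  choose P hPmem hPmax using key
  obtain ⟨⟨x, y⟩, hxy, s, hs, hlim⟩ := ((isCompact_closedBall c r).prod
      (isCompact_closedBall c r)).tendsto_subseq hPmem
  have c4 : Continuous (fun P : Euc n × Euc n => pen (P.1 - P.2)) := by fun_prop
  have c5 : Continuous (fun P : Euc n × Euc n =>
    u₁ i P.1 + u₂ i P.2 - ψ P.1 - pen (P.1 - c)) := by fun_prop
  have t4 := (c4.tendsto (x, y)).comp hlim
  have t5 := (c5.tendsto (x, y)).comp hlim
  dsimp only at t4 t5
  have hval : ∀ K, u₁ i c + u₂ i c - ψ c ≤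
      u₁ i (P K).1 + u₂ i (P K).2 - ψ (P K).1 - pen ((P K).1 - c)
        - K * pen ((P K).1 - (P K).2) := by
    intro K
    have := hPmax K c hcc c hcc
    simpa [pen_zero] using this
  have e1 : pen (x - y) ≤ 0 := by
    refine lim_pen hs t4 (t5.sub_const (u₁ i c + u₂ i c - ψ c)) fun K => ?_
    have := hval (s K)
    simp only [Function.comp]
    linarith
  have e2 : u₁ i c + u₂ i c - ψ c ≤ u₁ i x + u₂ i y - ψ x - pen (x - c) := by
    refine ge_of_tendsto t5 (Eventually.of_forall fun K => ?_)
    have h1 := hval (s K)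
    have h2 : 0 ≤ (s K : ℝ) * pen ((P (s K)).1 - (P (s K)).2) :=
      mul_nonneg (Nat.cast_nonneg _) (pen_nonneg _)
    simp only [Function.comp]
    linarith
  have e3 : x = y := pen_close hr3 hxy.1 hxy.2 e1
  subst e3
  have e4 : x = c := by
    refine pen_close hr3 hxy.1 hcc ?_
    linarith [hloc x hxy.1]
  subst e4
  have hrε : 0 < min r ε := lt_min hrpos hε
  have hev : ∀ᶠ K in atTop, (P (s K)) ∈ Metric.ball x (min r ε) ×ˢ Metric.ball x (min r ε) :=
    hlim.eventually ((Metric.isOpen_ball.prod Metric.isOpen_ball).mem_nhds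
      ⟨Metric.mem_ball_self hrε, Metric.mem_ball_self hrε⟩)
  obtain ⟨K, hK⟩ := hev.exists
  generalize s K = N at hK
  have hmax := hPmax N
  generalize P N = Q at hK hmax
  obtain ⟨a, b⟩ := Q
  obtain ⟨ha, hb⟩ := hK
  simp only [Metric.mem_ball] at ha hb hmax
  have har : a ∈ Metric.ball x r := Metric.mem_ball.2 (ha.trans_le (min_le_left _ _))
  have hbr : b ∈ Metric.ball x r := Metric.mem_ball.2 (hb.trans_le (min_le_left _ _))
  set ψ₁ : Euc n → ℝ := fun a' => (ψ a' + pen (a' - x)) + N * pen (a' - b) with hψ₁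
  set ψ₂ : Euc n → ℝ := fun b' => N * pen (a - b') with hψ₂
  have hc1 : ContDiff ℝ 1 ψ₁ :=
    (hψ.add (pen_contDiff.comp (contDiff_id.sub contDiff_const))).add
      (contDiff_const.mul (pen_contDiff.comp (contDiff_id.sub contDiff_const)))
  have hc2 : ContDiff ℝ 1 ψ₂ :=
    contDiff_const.mul (pen_contDiff.comp (contDiff_const.sub contDiff_id))
  have ht1 : TorusFun ψ₁ := by
    intro a' w hw
    have q1 := pen_torus_sub x a' w hw
    have q2 := pen_torus_sub b a' w hw
    simp only at q1 q2
    simp only [hψ₁, q1, q2, hψt a' w hw]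
  have ht2 : TorusFun ψ₂ := by
    intro a' w hw
    have q1 := pen_torus_sub' a a' w hw
    simp only at q1
    simp only [hψ₂, q1]
  have hm1 : IsLocalMax (fun y => u₁ i y - ψ₁ y) a := by
    filter_upwards [Metric.isOpen_ball.mem_nhds har] with a' ha'
    have := hmax a' (Metric.ball_subset_closedBall ha') b (Metric.ball_subset_closedBall hbr)
    simp only [hψ₁]
    linarith
  have hm2 : IsLocalMax (fun y => u₂ i y - ψ₂ y) b := by
    filter_upwards [Metric.isOpen_ball.mem_nhds hbr] with b' hb'
    have := hmax a (Metric.ball_subset_closedBall har) b' (Metric.ball_subset_closedBall hb')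
    simp only [hψ₂]
    linarith
  have hψd := hψ.differentiable one_ne_zero
  have g1 : gradient ψ₁ a = gradient ψ a + gradient pen (a - x) - gradient ψ₂ b := by
    simp only [hψ₁, hψ₂]
    rw [grad_add ((hψd a).fun_add (pen_diff_sub a x)) ((pen_diff_sub a b).const_mul _),
      grad_add (hψd a) (pen_diff_sub a x), grad_mul (pen_diff_sub a b),
      grad_mul (pen_diff_sub' a b), grad_pen_sub, grad_pen_sub, grad_pen_sub']
    simp
  refine ⟨a, b, gradient ψ₂ b, ha.trans_le (min_le_right _ _), hb.trans_le (min_le_right _ _),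
    hR i ψ₂ hc2 ht2 b hm2, fun ξ => ?_, fun ξ => sub_pt hgL h₂ i ψ₂ hc2 ht2 b hm2 ξ⟩
  rw [← g1]
  exact sub_pt hgL h₁ i ψ₁ hc1 ht1 a hm1 ξ

theorem memF_add (hgL : GoodData g L) (hcoer : Coercive g L) (hB : GoodCoupling B)
    {φ₁ φ₂ : Fin m → Euc n × Ξ → ℝ} {u₁ u₂ : Fin m → Euc n → ℝ}
    (h₁ : memF B lam g φ₁ u₁) (h₂ : memF B lam g φ₂ u₂) :
    memF B lam g (fun i q => φ₁ i q + φ₂ i q) (fun i x => u₁ i x + u₂ i x) := by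
  have hcu : ∀ i, Continuous (fun x => u₁ i x + u₂ i x) := fun i => (h₁.2.1 i).add (h₂.2.1 i)
  refine ⟨fun i => ⟨(h₁.1 i).1.add (h₂.1 i).1, ?_⟩, hcu,
    fun i => ⟨(hcu i).upperSemicontinuous, ?_⟩, ?_⟩
  · intro x w ξ hw
    simp only [(h₁.1 i).2 x w ξ hw, (h₂.1 i).2 x w ξ hw]
  · intro x w hw
    simp only [(h₁.2.2.1 i).2 x w hw, (h₂.2.2.1 i).2 x w hw]
  intro i ψ hψ hψt c hc
  obtain ⟨R, hR⟩ := sum_approx hgL hcoer hB h₁ h₂ i hψ hψt hc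
  have hpos : ∀ N : ℕ, (0 : ℝ) < 1 / ((N : ℝ) + 1) := fun N => by positivity
  choose x y q hx hy hq hs1 hs2 using fun N : ℕ => hR (1 / ((N : ℝ) + 1)) (hpos N)
  obtain ⟨p, -, s, hs, hlim⟩ := (isCompact_closedBall (0 : Euc n) R).tendsto_subseq
    (x := q) (fun N => by simpa using hq N)
  have h0 := tendsto_one_div_add_atTop_nhds_zero_nat (𝕜 := ℝ)
  have lx : Tendsto (fun N => x (s N)) atTop (𝓝 c) := by
    refine Tendsto.comp (g := x) ?_ hs.tendsto_atTop
    rw [tendsto_iff_dist_tendsto_zero]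
    exact squeeze_zero (fun _ => dist_nonneg) (fun N => (hx N).le) h0
  have ly : Tendsto (fun N => y (s N)) atTop (𝓝 c) := by
    refine Tendsto.comp (g := y) ?_ hs.tendsto_atTop
    rw [tendsto_iff_dist_tendsto_zero]
    exact squeeze_zero (fun _ => dist_nonneg) (fun N => (hy N).le) h0
  have hgc := fun i => (hgL.1 i).1
  have hgψ := grad_cont hψ
  have hgp := grad_cont (pen_contDiff (n := n))
  have cgr : Continuous (fun a => gradient ψ a + gradient pen (a - c)) := by fun_prop
  have lp := ((cgr.tendsto c).comp lx).sub hlim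
  have key1 : ∀ ξ, opv B lam g φ₁ u₁ i c ξ (gradient ψ c - p) ≤ 0 := by
    intro ξ
    have h := (opv_cont (lam := lam) hB hgc (fun i => (h₁.1 i).1) h₁.2.1 i).tendsto
      (c, ξ, gradient ψ c - p)
    simp only [sub_self, grad_pen_zero, add_zero] at lp
    have h' := h.comp (lx.prodMk_nhds ((tendsto_const_nhds (x := ξ)).prodMk_nhds lp))
    exact le_of_tendsto h' (Eventually.of_forall fun N => hs1 (s N) ξ)
  have key2 : ∀ ξ, opv B lam g φ₂ u₂ i c ξ p ≤ 0 := by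
    intro ξ
    have h := (opv_cont (lam := lam) hB hgc (fun i => (h₂.1 i).1) h₂.2.1 i).tendsto (c, ξ, p)
    have h' := h.comp (ly.prodMk_nhds ((tendsto_const_nhds (x := ξ)).prodMk_nhds hlim))
    exact le_of_tendsto h' (Eventually.of_forall fun N => hs2 (s N) ξ)
  have : ham g (fun i q => φ₁ i q + φ₂ i q) i c (gradient ψ c) ≤
      -(lam * (u₁ i c + u₂ i c) + ∑ j, B c i j * (u₁ j c + u₂ j c)) := by
    refine ciSup_le fun ξ => ?_
    have h1 := key1 ξ
    have h2 := key2 ξ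
    unfold opv at h1 h2
    rw [inner_sub_right] at h1
    simp only [mul_add, Finset.sum_add_distrib]
    linarith
  simp only
  linarith

theorem memF_smul {φ : Fin m → Euc n × Ξ → ℝ} {u : Fin m → Euc n → ℝ} (hgL : GoodData g L)
    (h : memF B lam g φ u) {c : ℝ} (hc : 0 < c) :
    memF B lam g (fun i q => c * φ i q) (fun i x => c * u i x) := by
  have hcu : ∀ i, Continuous (fun x => c * u i x) := fun i => continuous_const.mul (h.2.1 i)
  refine ⟨fun i => ⟨continuous_const.mul (h.1 i).1, ?_⟩, hcu,
    fun i => ⟨(hcu i).upperSemicontinuous, ?_⟩, ?_⟩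
  · intro x w ξ hw
    simp only [(h.1 i).2 x w ξ hw]
  · intro x w hw
    simp only [(h.2.2.1 i).2 x w hw]
  intro i ψ hψ hψt x hx
  have hψd := hψ.differentiable one_ne_zero
  have h1 := sub_pt hgL h i (fun a => c⁻¹ * ψ a) (contDiff_const.mul hψ)
    (by intro a w hw; simp only [hψt a w hw]) x
    (by
      filter_upwards [hx] with a ha
      have := mul_le_mul_of_nonneg_left ha (inv_pos.2 hc).le
      simp only [mul_sub, inv_mul_cancel_left₀ hc.ne'] at this
      exact this)
  have : ham g (fun i q => c * φ i q) i x (gradient ψ x) ≤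
      -(lam * (c * u i x) + ∑ j, B x i j * (c * u j x)) := by
    refine ciSup_le fun ξ => ?_
    have h2 := mul_le_mul_of_nonneg_left (h1 ξ) hc.le
    rw [grad_mul (hψd x), inner_smul_right] at h2
    have e : ∑ j, B x i j * (c * u j x) = c * ∑ j, B x i j * u j x := by
      rw [Finset.mul_sum]
      exact Finset.sum_congr rfl fun j _ => by ring
    rw [e]
    have e2 : c * (c⁻¹ * ⟪g i (x, ξ), gradient ψ x⟫) = ⟪g i (x, ξ), gradient ψ x⟫ :=
      mul_inv_cancel_left₀ hc.ne' _
    linarith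
  simp only
  linarith

theorem memF_mono {φ φ' : Fin m → Euc n × Ξ → ℝ} {u : Fin m → Euc n → ℝ} (hgL : GoodData g L)
    (h : memF B lam g φ u) (h' : ∀ i, Continuous (φ' i) ∧ TorusFun2 (φ' i))
    (hle : ∀ i q, φ i q ≤ φ' i q) : memF B lam g φ' u := by
  refine ⟨h', h.2.1, h.2.2.1, fun i ψ hψ hψt x hx => ?_⟩
  have : ham g φ' i x (gradient ψ x) ≤ -(lam * u i x + ∑ j, B x i j * u j x) := by
    refine ciSup_le fun ξ => ?_
    have := sub_pt hgL h i ψ hψ hψt x hx ξ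
    linarith [hle i (x, ξ)]
  simp only
  linarith

theorem rho_cont (hB : GoodCoupling B) (i : Fin m) : Continuous (rhoB B i) :=
  continuous_finsetSum _ fun j _ => (hB.1 i j).1

theorem rho_torus (hB : GoodCoupling B) (i : Fin m) : TorusFun (rhoB B i) := by
  intro x w hw
  have h1 : ∀ j, B (x + w) i j = B x i j := fun j => (hB.1 i j).2 x w hw
  simp only [rhoB, h1]

theorem rho_nonneg (hB : GoodCoupling B) (i : Fin m) (x : Euc n) : 0 ≤ rhoB B i x := by
  have := hB.2 x (fun _ => 1) i (fun _ => le_rfl) zero_le_one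
  simpa [rhoB] using this

/-- Constants. -/
theorem memF_const (hB : GoodCoupling B) (c : ℝ) :
    memF B lam g (fun i q => c * (lam + rhoB B i q.1)) (fun _ _ => c) := by
  refine ⟨fun i => ⟨?_, ?_⟩, fun i => continuous_const,
    fun i => ⟨continuous_const.upperSemicontinuous, fun _ _ _ => rfl⟩, ?_⟩
  · have := rho_cont hB i
    fun_prop
  · intro x w ξ hw
    simp only [rho_torus hB i x w hw]
  intro i ψ hψ hψt x hx
  have h1 : IsLocalMin ψ x := by
    filter_upwards [hx] with a ha
    linarith
  have h2 : gradient ψ x = 0 := by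
    unfold gradient
    rw [h1.fderiv_eq_zero, map_zero]
  rw [h2]
  have : ham g (fun i q => c * (lam + rhoB B i q.1)) i x 0 ≤ -(lam * c + ∑ j, B x i j * c) := by
    refine ciSup_le fun ξ => ?_
    rw [inner_zero_right, ← Finset.sum_mul]
    unfold rhoB
    linarith
  simp only
  linarith

end Main

theorem exists_measure_of_pos {K : Type*} [TopologicalSpace K] [CompactSpace K] [T2Space K]
    [MeasurableSpace K] [BorelSpace K] (l : C(K, ℝ) →ₗ[ℝ] ℝ)
    (hl : ∀ f : C(K, ℝ), (∀ x, 0 ≤ f x) → 0 ≤ l f) :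
    ∃ μ : Measure K, IsFiniteMeasure μ ∧ ∀ f : C(K, ℝ), ∫ x, f x ∂μ = l f := by
  let e : CompactlySupportedContinuousMap K ℝ →ₗ[ℝ] C(K, ℝ) :=
    { toFun := fun f => f.toContinuousMap
      map_add' := fun f h => rfl
      map_smul' := fun c f => rfl }
  let P : CompactlySupportedContinuousMap K ℝ →ₚ[ℝ] ℝ :=
    PositiveLinearMap.mk₀ (l.comp e) (fun f hf => hl _ fun x => hf x)
  refine ⟨RealRMK.rieszMeasure P, inferInstance, fun f => ?_⟩
  exact RealRMK.integral_rieszMeasure P (CompactlySupportedContinuousMap.continuousMapEquiv f)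

/-- The compact space carrying the test functions. -/
abbrev KK (n : ℕ) (Ξ : Type*) := Metric.closedBall (0 : Euc n) (n : ℝ) × Ξ

theorem extend_le {n : ℕ} {Ξ : Type*} {f h : Euc n × Ξ → ℝ} (hf : TorusFun2 f)
    (hh : TorusFun2 h)
    (hle : ∀ q : Metric.closedBall (0 : Euc n) n × Ξ, f (q.1, q.2) ≤ h (q.1, q.2)) (q) :
    f q ≤ h q := by
  obtain ⟨x, ξ⟩ := q
  obtain ⟨w, hw, hx⟩ := exists_rep x
  have := hle (⟨x + w, hx⟩, ξ)
  simpa [hf x w ξ hw, hh x w ξ hw] using this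

set_option maxHeartbeats 1000000 in
theorem stmt6 {n m : ℕ} (hn : 0 < n) (hm : 0 < m)
    {Ξ : Type*} [MetricSpace Ξ] [CompactSpace Ξ] [Nonempty Ξ]
    [MeasurableSpace Ξ] [BorelSpace Ξ]
    (g : Fin m → Euc n × Ξ → Euc n) (L : Fin m → Euc n × Ξ → ℝ)
    (hgL : GoodData g L) (hcoer : Coercive g L)
    (B : Euc n → Matrix (Fin m) (Fin m) ℝ) (hB : GoodCoupling B)
    (lam : ℝ) (hlam : 0 < lam) (z : Euc n) (k : Fin m)
    (v : Fin m → Euc n → ℝ) (hv : IsSol B lam g L (fun _ => 0) v) :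
    ∃ ν : Fin m → Measure (Euc n × Ξ), memGP B lam g z k ν ∧
      v k z = ∑ i, ∫ q, L i q ∂(ν i) := by

  have hrc := rho_cont hB
  have hrt := rho_torus hB
  have hr0 := rho_nonneg hB
  have hvF : memF B lam g L v := ⟨hgL.2, hv.1, hv.2.1⟩
  have hzeroF : memF B lam g (fun _ _ => 0) (fun _ _ => 0) := by
    have := memF_const (lam := lam) (g := g) hB 0
    simpa using this
  have hcmp : ∀ u t, 0 ≤ t → memF B lam g (fun i q => t * L i q) u → u k z ≤ t * v k z := by
    intro u t ht hu
    have h1 := memF_add hgL hcoer hB hu hvF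
    have hpos : 0 < t + 1 := by linarith
    have h2 := memF_smul hgL h1 (inv_pos.2 hpos)
    have h3 : memF B lam g L (fun i x => (t + 1)⁻¹ * (u i x + v i x)) := by
      refine memF_mono hgL h2 hgL.2 fun i q => le_of_eq ?_
      field_simp
    have h4 := comparison hgL hcoer hB hlam h3 hv.1 hv.2.2 k z
    rw [inv_mul_le_iff₀ hpos] at h4
    linarith
  have : CompactSpace (Metric.closedBall (0 : Euc n) n) :=
    isCompact_iff_compactSpace.1 (isCompact_closedBall (0 : Euc n) n)
  let ι : KK n Ξ → Euc n × Ξ := fun q => (q.1, q.2)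
  have hι : Continuous ι := by fun_prop
  let b : Fin m → C(KK n Ξ, ℝ) := fun i => ⟨fun q => lam + rhoB B i q.1, by have := hrc i; fun_prop⟩
  let S : PointedCone ℝ (Fin m → C(KK n Ξ, ℝ)) :=
    { carrier := {f | ∃ φ u t, memF B lam g φ u ∧ 0 ≤ t ∧ ∀ i (q : KK n Ξ),
        φ i (ι q) - u k z * (lam + rhoB B i q.1)
          - t * (L i (ι q) - v k z * (lam + rhoB B i q.1)) ≤ f i q}
      add_mem' := by
        rintro f f' ⟨φ, u, t, hF, ht, hle⟩ ⟨φ', u', t', hF', ht', hle'⟩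
        refine ⟨_, _, t + t', memF_add hgL hcoer hB hF hF', by linarith, fun i q => ?_⟩
        have h1 := hle i q
        have h2 := hle' i q
        rw [show (f + f') i q = f i q + f' i q from rfl]
        linarith
      zero_mem' := ⟨_, _, 0, hzeroF, le_rfl, fun i q => by
        rw [show ((0 : Fin m → C(KK n Ξ, ℝ)) i) q = 0 from rfl]; simp⟩
      smul_mem' := by
        rintro ⟨c, hc⟩ f ⟨φ, u, t, hF, ht, hle⟩
        rcases hc.eq_or_lt with h0 | hc
        · subst h0
          refine ⟨_, _, 0, hzeroF, le_rfl, fun i q => ?_⟩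
          have : ((⟨0, hc⟩ : {c : ℝ // 0 ≤ c}) • f) i q = (0 : ℝ) * f i q := rfl
          rw [this]
          simp
        · refine ⟨_, _, c * t, memF_smul hgL hF hc, by positivity, fun i q => ?_⟩
          have : ((⟨c, hc.le⟩ : {c : ℝ // 0 ≤ c}) • f) i q = c * f i q := rfl
          rw [this]
          have := mul_le_mul_of_nonneg_left (hle i q) hc.le
          linarith }
  have hSmem : ∀ f : (Fin m → C(KK n Ξ, ℝ)), f ∈ S ↔ ∃ φ u t, memF B lam g φ u ∧ 0 ≤ t ∧ ∀ i (q : KK n Ξ),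
        φ i (ι q) - u k z * (lam + rhoB B i q.1)
          - t * (L i (ι q) - v k z * (lam + rhoB B i q.1)) ≤ f i q := fun f => Iff.rfl
  have hSpos : ∀ f : (Fin m → C(KK n Ξ, ℝ)), (∀ i q, 0 ≤ f i q) → f ∈ S := by
    intro f hf
    rw [hSmem]
    refine ⟨_, _, 0, hzeroF, le_rfl, fun i q => ?_⟩
    simpa using hf i q
  have q0 : KK n Ξ := (⟨0, by simp⟩, Classical.arbitrary Ξ)
  have hb : b ≠ 0 := by
    intro h
    have h1 : b k q0 = 0 := by rw [h]; rfl
    have h2 : b k q0 = lam + rhoB B k q0.1 := rfl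
    linarith [hr0 k q0.1]
  obtain ⟨l, hl1, hl2⟩ := riesz_extension S (LinearPMap.mkSpanSingleton b (1 : ℝ) hb)
    (by
      rintro ⟨x, hx⟩ hxS
      obtain ⟨c, rfl⟩ := Submodule.mem_span_singleton.1 hx
      rw [LinearPMap.mkSpanSingleton'_apply]
      simp only [RingHom.id_apply, smul_eq_mul, mul_one]
      obtain ⟨φ, u, t, hF, ht, hle⟩ := (hSmem _).1 hxS
      have hcl := memF_add hgL hcoer hB hF
        (memF_const (lam := lam) (g := g) hB (-(c + u k z - t * v k z)))
      have hmono : memF B lam g (fun i q => t * L i q)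
          (fun i x => u i x + -(c + u k z - t * v k z)) := by
        refine memF_mono hgL hcl (fun i => ⟨continuous_const.mul (hgL.2 i).1, ?_⟩) fun i q => ?_
        · intro x w ξ hw
          simp only [(hgL.2 i).2 x w ξ hw]
        · refine extend_le (h := fun q => t * L i q) (hcl.1 i).2 ?_ (fun q => ?_) q
          · intro x w ξ hw
            simp only [(hgL.2 i).2 x w ξ hw]
          · have h1 := hle i q
            have h2 : (c • b) i q = c * (lam + rhoB B i q.1) := rfl
            rw [h2] at h1
            simp only [ι] at h1
            simp only
            linarith
      have := hcmp _ t ht hmono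
      linarith)
    (by
      intro y
      have hbd : ∀ i, ∃ C, ∀ q, ‖y i q‖ ≤ C := fun i => ⟨‖y i‖, fun q => (y i).norm_coe_le_norm q⟩
      choose C hC using hbd
      have hCn : ∀ i, 0 ≤ C i := fun i => (norm_nonneg _).trans (hC i q0)
      refine ⟨⟨((∑ i, C i) / lam) • b, Submodule.mem_span_singleton.2 ⟨_, rfl⟩⟩, ?_⟩
      refine hSpos _ fun i q => ?_
      have h2 : (((∑ i, C i) / lam) • b + y) i q
        = (∑ i, C i) / lam * (lam + rhoB B i q.1) + y i q := rfl
      rw [h2]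
      have h3 : C i ≤ ∑ i, C i := Finset.single_le_sum (fun i _ => hCn i) (Finset.mem_univ i)
      have h4 : (0 : ℝ) ≤ (∑ i, C i) / lam := div_nonneg ((hCn i).trans h3) hlam.le
      have h5 := mul_nonneg h4 (hr0 i q.1)
      have h6 : (∑ i, C i) / lam * lam = ∑ i, C i := div_mul_cancel₀ _ hlam.ne'
      have h7 := (abs_le.1 (hC i q)).1
      rw [mul_add, h6]
      linarith)
  have hlb : l b = 1 := by
    have := hl1 ⟨b, Submodule.mem_span_singleton_self b⟩
    rwa [LinearPMap.mkSpanSingleton_apply] at this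
  -- measures
  have hmeas : ∀ i, ∃ μ : Measure (KK n Ξ), IsFiniteMeasure μ ∧
      ∀ f : C(KK n Ξ, ℝ), ∫ x, f x ∂μ = l (LinearMap.single ℝ (fun _ => C(KK n Ξ, ℝ)) i f) := by
    intro i
    refine exists_measure_of_pos (l.comp (LinearMap.single ℝ (fun _ => C(KK n Ξ, ℝ)) i)) fun f hf => ?_
    refine hl2 _ (hSpos _ fun j q => ?_)
    rw [LinearMap.single_apply]
    by_cases hij : j = i
    · subst hij; simpa using hf q
    · simp [Pi.single_eq_of_ne hij]
  choose μ hμfin hμ using hmeas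
  have hsum : ∀ f : (Fin m → C(KK n Ξ, ℝ)), l f = ∑ i, ∫ q, f i q ∂(μ i) := by
    intro f
    simp only [hμ]
    rw [← map_sum]
    congr 1
    exact (LinearMap.sum_single_apply (fun _ => C(KK n Ξ, ℝ)) f).symm
  have hmap : ∀ i (f : Euc n × Ξ → ℝ), Continuous f →
      ∫ q, f q ∂((μ i).map ι) = ∫ q, f (ι q) ∂(μ i) := fun i f hf =>
    integral_map hι.measurable.aemeasurable hf.aestronglyMeasurable
  have hνsum : ∀ f : Fin m → Euc n × Ξ → ℝ, ∀ hf : ∀ i, Continuous (f i),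
      ∑ i, ∫ q, f i q ∂((μ i).map ι) = l (fun i => ⟨fun q => f i (ι q), (hf i).comp hι⟩) := by
    intro f hf
    rw [hsum]
    exact Finset.sum_congr rfl fun i _ => hmap i _ (hf i)
  have hbc : ∀ i, Continuous (fun q : Euc n × Ξ => lam + rhoB B i q.1) := fun i => by
    have := hrc i
    fun_prop
  have hφge : ∀ φ u, memF B lam g φ u →
      0 ≤ ∑ i, ∫ q, (φ i q - u k z * (lam + rhoB B i q.1)) ∂((μ i).map ι) := by
    intro φ u hF
    rw [hνsum (fun i q => φ i q - u k z * (lam + rhoB B i q.1))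
      (fun i => (hF.1 i).1.sub (continuous_const.mul (hbc i)))]
    refine hl2 _ ((hSmem _).2 ⟨φ, u, 0, hF, le_rfl, fun i q => ?_⟩)
    rw [zero_mul, sub_zero]
    exact le_rfl
  refine ⟨fun i => (μ i).map ι, ⟨⟨fun i => inferInstance, ?_⟩, hφge⟩, ?_⟩
  · rw [hνsum (fun i q => lam + rhoB B i q.1) hbc]
    exact hlb
  · have h1 := hφge L v hvF
    have hcL : ∀ i, Continuous (fun q : Euc n × Ξ => L i q - v k z * (lam + rhoB B i q.1)) :=
      fun i => (hgL.2 i).1.sub (continuous_const.mul (hbc i))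
    rw [hνsum (fun i q => L i q - v k z * (lam + rhoB B i q.1)) hcL] at h1
    rw [hνsum L (fun i => (hgL.2 i).1)]
    set LX : Fin m → C(KK n Ξ, ℝ) := fun i => ⟨fun q => L i (ι q), ((hgL.2 i).1).comp hι⟩ with hLX
    have e1 : (fun i => ⟨fun q => L i (ι q) - v k z * (lam + rhoB B i (ι q).1),
        (hcL i).comp hι⟩ : (Fin m → C(KK n Ξ, ℝ))) = LX - v k z • b := rfl
    have h2 : 0 ≤ l (-(LX - v k z • b)) := by
      refine hl2 _ ((hSmem _).2 ⟨_, _, 1, hzeroF, zero_le_one, fun i q => ?_⟩)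
      have : (-(LX - v k z • b)) i q = -(L i (ι q) - v k z * (lam + rhoB B i q.1)) := rfl
      rw [this]
      linarith
    have h1' : 0 ≤ l (LX - v k z • b) := h1
    rw [map_neg] at h2
    rw [map_sub, map_smul, hlb, smul_eq_mul, mul_one] at h1' h2
    linarith
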